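/- arXiv:1708.08663 — 4 statements merged into one kernel-verified Lean document; each statement's English description precedes it below -/
import Mathlib

section
/- There exists an absolute constant C > 0 with the following property. Let λ₁ ≥ λ₂ ≥ … ≥ λ_p > 0 satisfy 3λ₁² ≤ Λ², where Λ² = ∑_{j=1}^p λ_j². Let h_j(t) = (1 + λ_j² t²)^{-1/4} for j = 1, …, p. Then ∫₀^∞ ∏_{j=1}^p h_j(t) dt ≤ C / Λ. -/
open MeasureTheory

/-- Among products `∏ (1 + aⱼ x)` with `∑ aⱼ = 3 b` and `0 ≤ aⱼ ≤ b`, the smallest is attained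
by three factors with `aⱼ = b`. -/
theorem one_add_mul_pow_three_le_prod {ι : Type*} [Fintype ι] (a : ι → ℝ) {b x : ℝ}
    (hb : 0 < b) (hx : 0 ≤ x) (ha : ∀ j, 0 ≤ a j) (hab : ∀ j, a j ≤ b)
    (hsum : ∑ j, a j = 3 * b) : (1 + b * x) ^ (3 : ℝ) ≤ ∏ j, (1 + a j * x) := by
  have hpos : 0 < 1 + b * x := by positivity
  have hweights : ∑ j, a j / b = 3 := by
    rw [← Finset.sum_div, hsum]
    field_simp
  rw [← hweights, Real.rpow_sum_of_pos hpos]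
  refine Finset.prod_le_prod (fun j _ => by positivity) fun j _ => ?_
  calc (1 + b * x) ^ (a j / b) ≤ 1 + a j / b * (b * x) :=
        rpow_one_add_le_one_add_mul_self (by linarith) (div_nonneg (ha j) hb.le)
          ((div_le_one hb).2 (hab j))
    _ = 1 + a j * x := by field_simp

theorem integrable_one_add_sq_rpow :
    Integrable fun t : ℝ => (1 + t ^ 2) ^ (-(3 : ℝ) / 4) := by
  have h := integrable_rpow_neg_one_add_norm_sq (E := ℝ) (μ := volume) (r := 3 / 2)
    (by norm_num)
  convert h using 3 with t
  · simp
  · norm_num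

/-- **Lemma A.2.** There is an absolute constant `C > 0` such that for any finite
non-increasing sequence `λ₁ ≥ … ≥ λ_p > 0` with `3λ₁² ≤ Λ² = ∑ⱼ λⱼ²`, the functions
`h_j(t) = (1 + λ_j² t²)^{-1/4}` satisfy `∫₀^∞ ∏ⱼ h_j(t) dt ≤ C / Λ`. -/
theorem product_charfun_integral_bound :
    ∃ C : ℝ, 0 < C ∧
      ∀ (p : ℕ) (hp : 0 < p) (lam : Fin p → ℝ),
        (∀ j, 0 < lam j) → Antitone lam →
        3 * (lam ⟨0, hp⟩) ^ 2 ≤ ∑ j, (lam j) ^ 2 →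
        ∫ t in Set.Ioi (0 : ℝ), ∏ j, (1 + (lam j) ^ 2 * t ^ 2) ^ (-(1 : ℝ) / 4) ≤
          C / Real.sqrt (∑ j, (lam j) ^ 2) := by
  set I : ℝ := ∫ t in Set.Ioi (0 : ℝ), (1 + t ^ 2) ^ (-(3 : ℝ) / 4)
  have hI0 : 0 ≤ I := integral_nonneg fun t => by positivity
  refine ⟨√3 * (I + 1), by positivity, fun p hp lam hpos hanti hmax => ?_⟩
  set S := ∑ j, (lam j) ^ 2
  have hS : 0 < S := by
    have := pow_pos (hpos ⟨0, hp⟩) 2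
    linarith
  have hb : 0 < S / 3 := by positivity
  have hle : ∀ j, lam j ^ 2 ≤ S / 3 := fun j => by
    have h0 : lam j ≤ lam ⟨0, hp⟩ := hanti (Fin.mk_le_of_le_val (Nat.zero_le _))
    have := pow_le_pow_left₀ (hpos j).le h0 2
    linarith
  have hc : 0 < √(S / 3) := Real.sqrt_pos.2 hb
  have hbound : ∀ t : ℝ, ∏ j, (1 + (lam j) ^ 2 * t ^ 2) ^ (-(1 : ℝ) / 4) ≤
      (1 + (√(S / 3) * t) ^ 2) ^ (-(3 : ℝ) / 4) := fun t => by
    rw [Real.finsetProd_rpow _ _ fun j _ => by positivity, mul_pow, Real.sq_sqrt hb.le,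
      show (-(3 : ℝ) / 4) = 3 * (-1 / 4) by norm_num, Real.rpow_mul (by positivity)]
    exact Real.rpow_le_rpow_of_nonpos (by positivity)
      (one_add_mul_pow_three_le_prod (fun j => lam j ^ 2) hb (sq_nonneg t)
        (fun j => sq_nonneg _) hle (by ring)) (by norm_num)
  calc ∫ t in Set.Ioi (0 : ℝ), ∏ j, (1 + (lam j) ^ 2 * t ^ 2) ^ (-(1 : ℝ) / 4)
      ≤ ∫ t in Set.Ioi (0 : ℝ), (1 + (√(S / 3) * t) ^ 2) ^ (-(3 : ℝ) / 4) :=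
        integral_mono_of_nonneg
          (.of_forall fun t => Finset.prod_nonneg fun j _ => by positivity)
          (integrable_one_add_sq_rpow.comp_mul_left' hc.ne').integrableOn (.of_forall hbound)
    _ = (√(S / 3))⁻¹ * I := by
        rw [integral_comp_mul_left_Ioi (fun t : ℝ => (1 + t ^ 2) ^ (-(3 : ℝ) / 4)) 0 hc,
          mul_zero, smul_eq_mul]
    _ = √3 * I / √S := by
        rw [Real.sqrt_div hS.le, inv_div]
        ring
    _ ≤ √3 * (I + 1) / √S := by
        gcongr
        linarith
end

section
/- Let ξ₁ ~ N(0, λ₁) and ξ₂ ~ N(0, λ₂) be independent real Gaussian random variables with λ₁, λ₂ > 0, and let a₁, a₂ ∈ ℝ. Then the probability density function g(2, ·) of (ξ₁ − a₁)² + (ξ₂ − a₂)² satisfies sup_{x ≥ 0} g(2, x) ≤ 1 / (2 √(λ₁ λ₂)). -/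
open MeasureTheory ProbabilityTheory Real NNReal

/-- A finite measure bounded by a multiple `C` of a σ-finite measure has a real density that is
everywhere at most `C`. -/
lemma exists_density_le_of_le_smul {α : Type*} [MeasurableSpace α] {μ ν : Measure α}
    [IsFiniteMeasure μ] [SigmaFinite ν] {C : ℝ} (hC : 0 ≤ C) (h : μ ≤ ENNReal.ofReal C • ν) :
    ∃ g : α → ℝ, μ = ν.withDensity (fun x => ENNReal.ofReal (g x)) ∧ ∀ x, g x ≤ C := by
  have hac : μ ≪ ν := (Measure.absolutelyContinuous_of_le h).trans
    Measure.smul_absolutelyContinuous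
  have hle : ∀ᵐ x ∂ν, μ.rnDeriv ν x ≤ ENNReal.ofReal C := by
    refine ae_le_of_forall_setLIntegral_le_of_sigmaFinite (Measure.measurable_rnDeriv μ ν)
      fun s _ _ => ?_
    rw [setLIntegral_const]
    exact (Measure.setLIntegral_rnDeriv_le s).trans (h s)
  refine ⟨fun x => min (μ.rnDeriv ν x).toReal C, ?_, fun x => min_le_right _ _⟩
  refine (Measure.withDensity_rnDeriv_eq μ ν hac).symm.trans (withDensity_congr_ae ?_)
  filter_upwards [hle] with x hx
  rw [min_eq_left (ENNReal.toReal_le_of_le_ofReal hC hx),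
    ENNReal.ofReal_toReal (hx.trans_lt ENNReal.ofReal_lt_top).ne]

/-- The pushforward of planar Lebesgue measure under the squared Euclidean norm is at most
`π` times Lebesgue measure. -/
lemma map_sq_add_sq_volume_le :
    Measure.map (fun y : ℝ × ℝ => y.1 ^ 2 + y.2 ^ 2) volume ≤
      ENNReal.ofReal π • (volume : Measure ℝ) := by
  have hm : Measurable fun y : ℝ × ℝ => y.1 ^ 2 + y.2 ^ 2 := by fun_prop
  refine Measure.le_iff.2 fun s hs => ?_
  let f : ℝ → ENNReal := s.indicator 1
  have hf : Measurable f := measurable_one.indicator hs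
  have hradial : Measurable fun r : ℝ => ENNReal.ofReal r * f (r ^ 2) := by fun_prop
  have hsq : ∫⁻ x in (fun r : ℝ => r ^ 2) '' Set.Ioi 0, f x =
      ∫⁻ r in Set.Ioi (0 : ℝ), 2 * (ENNReal.ofReal r * f (r ^ 2)) := by
    rw [lintegral_image_eq_lintegral_abs_deriv_mul measurableSet_Ioi
      (fun r _ => (hasDerivAt_pow 2 r).hasDerivWithinAt)
      (fun a ha b hb hab => (sq_eq_sq₀ (le_of_lt ha) (le_of_lt hb)).1 hab)]
    refine setLIntegral_congr_fun measurableSet_Ioi fun r hr => ?_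
    have hr' : (0 : ℝ) < r := hr
    simp [abs_of_pos hr', ENNReal.ofReal_mul, mul_assoc]
  calc Measure.map (fun y : ℝ × ℝ => y.1 ^ 2 + y.2 ^ 2) volume s
      = ∫⁻ y : ℝ × ℝ, f (y.1 ^ 2 + y.2 ^ 2) := by
        rw [← lintegral_map hf hm, lintegral_indicator_one hs]
    _ = ∫⁻ p in Set.Ioi (0 : ℝ) ×ˢ Set.Ioo (-π) π, ENNReal.ofReal p.1 * f (p.1 ^ 2) := by
        rw [← lintegral_comp_polarCoord_symm, polarCoord_target]
        refine lintegral_congr fun p => ?_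
        have : (p.1 * cos p.2) ^ 2 + (p.1 * sin p.2) ^ 2 = p.1 ^ 2 := by
          linear_combination p.1 ^ 2 * cos_sq_add_sin_sq p.2
        simp only [polarCoord_symm_apply, this, smul_eq_mul]
    _ = ∫⁻ r in Set.Ioi (0 : ℝ), ENNReal.ofReal π * (2 * (ENNReal.ofReal r * f (r ^ 2))) := by
        rw [Measure.volume_eq_prod, ← Measure.prod_restrict,
          lintegral_prod _ (by fun_prop)]
        refine lintegral_congr fun r => ?_
        dsimp only
        rw [setLIntegral_const, Real.volume_Ioo, sub_neg_eq_add, ← two_mul,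
          ENNReal.ofReal_mul zero_le_two, ENNReal.ofReal_ofNat]
        ring
    _ = ENNReal.ofReal π * ∫⁻ x in (fun r : ℝ => r ^ 2) '' Set.Ioi 0, f x := by
        rw [hsq, lintegral_const_mul _ (hradial.const_mul 2)]
    _ ≤ ENNReal.ofReal π * ∫⁻ x, f x := by
        gcongr
        exact Measure.restrict_le_self
    _ = (ENNReal.ofReal π • (volume : Measure ℝ)) s := by
        rw [lintegral_indicator_one hs]
        rfl

lemma gaussianReal_le_smul_volume (μ : ℝ) {v : ℝ≥0} (hv : v ≠ 0) :
    gaussianReal μ v ≤ ENNReal.ofReal (√(2 * π * v))⁻¹ • volume := by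
  rw [gaussianReal_of_var_ne_zero μ hv, ← withDensity_const]
  refine withDensity_mono (ae_of_all _ fun x => ENNReal.ofReal_le_ofReal ?_)
  refine mul_le_of_le_one_right (by positivity) (exp_le_one_iff.2 ?_)
  exact div_nonpos_of_nonpos_of_nonneg (neg_nonpos.2 (sq_nonneg _)) (by positivity)

/-- **Uniform bound for the density of a sum of two shifted squared Gaussians.** For
independent `ξ₁ ~ N(0, l₁)`, `ξ₂ ~ N(0, l₂)` with `l₁, l₂ > 0` and any `a₁, a₂ ∈ ℝ`, the
random variable `(ξ₁ - a₁)² + (ξ₂ - a₂)²` has a probability density `g` with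
`sup_{x ≥ 0} g x ≤ 1/(2 √(l₁ l₂))`. -/
theorem density_sum_two_squared_gaussians (l₁ l₂ : ℝ≥0) (h₁ : 0 < l₁) (h₂ : 0 < l₂)
    (a₁ a₂ : ℝ) :
    ∃ g : ℝ → ℝ,
      Measure.map (fun y : ℝ × ℝ => (y.1 - a₁) ^ 2 + (y.2 - a₂) ^ 2)
          ((gaussianReal 0 l₁).prod (gaussianReal 0 l₂)) =
        volume.withDensity (fun x => ENNReal.ofReal (g x)) ∧
      ∀ x : ℝ, 0 ≤ x → g x ≤ 1 / (2 * Real.sqrt ((l₁ : ℝ) * l₂)) := by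
  have hm : Measurable fun y : ℝ × ℝ => (y.1 - a₁) ^ 2 + (y.2 - a₂) ^ 2 := by fun_prop
  have : IsProbabilityMeasure (Measure.map (fun y : ℝ × ℝ => (y.1 - a₁) ^ 2 + (y.2 - a₂) ^ 2)
      ((gaussianReal 0 l₁).prod (gaussianReal 0 l₂))) :=
    Measure.isProbabilityMeasure_map hm.aemeasurable
  have hshift : Measure.map (fun y : ℝ × ℝ => (y.1 - a₁) ^ 2 + (y.2 - a₂) ^ 2) volume =
      Measure.map (fun y : ℝ × ℝ => y.1 ^ 2 + y.2 ^ 2) volume := by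
    conv_rhs => rw [← (measurePreserving_sub_right volume ((a₁, a₂) : ℝ × ℝ)).map_eq]
    rw [Measure.map_map (by fun_prop) (by fun_prop)]
    rfl
  have hconst : (√(2 * π * l₁))⁻¹ * (√(2 * π * l₂))⁻¹ * π = 1 / (2 * √((l₁ : ℝ) * l₂)) := by
    have hsqrt : √(2 * π * l₁) * √(2 * π * l₂) = 2 * π * √((l₁ : ℝ) * l₂) := by
      rw [← Real.sqrt_mul (by positivity),
        show 2 * π * l₁ * (2 * π * l₂) = (2 * π) ^ 2 * ((l₁ : ℝ) * l₂) by ring,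
        Real.sqrt_mul (by positivity), Real.sqrt_sq (by positivity)]
    rw [← mul_inv, hsqrt]
    field_simp
  have hprod : (gaussianReal 0 l₁).prod (gaussianReal 0 l₂) ≤
      (ENNReal.ofReal (√(2 * π * l₁))⁻¹ * ENNReal.ofReal (√(2 * π * l₂))⁻¹) •
        (volume : Measure (ℝ × ℝ)) := by
    refine (Measure.prod_mono (gaussianReal_le_smul_volume 0 h₁.ne')
      (gaussianReal_le_smul_volume 0 h₂.ne')).trans_eq ?_
    rw [Measure.prod_smul_left, Measure.prod_smul_right, smul_smul, Measure.volume_eq_prod]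
  obtain ⟨g, hg, hle⟩ := exists_density_le_of_le_smul (C := 1 / (2 * √((l₁ : ℝ) * l₂)))
    (by positivity) <| calc
      Measure.map (fun y : ℝ × ℝ => (y.1 - a₁) ^ 2 + (y.2 - a₂) ^ 2)
          ((gaussianReal 0 l₁).prod (gaussianReal 0 l₂))
        ≤ (ENNReal.ofReal (√(2 * π * l₁))⁻¹ * ENNReal.ofReal (√(2 * π * l₂))⁻¹) •
            Measure.map (fun y : ℝ × ℝ => y.1 ^ 2 + y.2 ^ 2) volume := by
          rw [← hshift, ← Measure.map_smul]
          exact Measure.map_mono hprod hm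
      _ ≤ (ENNReal.ofReal (√(2 * π * l₁))⁻¹ * ENNReal.ofReal (√(2 * π * l₂))⁻¹) •
            ENNReal.ofReal π • (volume : Measure ℝ) := by
          gcongr
          exact map_sq_add_sq_volume_le
      _ = ENNReal.ofReal (1 / (2 * √((l₁ : ℝ) * l₂))) • volume := by
          rw [smul_smul, ← ENNReal.ofReal_mul (by positivity),
            ← ENNReal.ofReal_mul (by positivity), hconst]
  exact ⟨g, hg, fun x _ => hle x⟩
end

section
/- (One-dimensional two-sided comparison) Let ξ ~ N(0, λ_ξ) and η ~ N(0, λ_η) be centered real Gaussians with 0 < λ_ξ < λ_η. Then there exist absolute constants 0 < c ≤ C such that c · (λ_η − λ_ξ)/λ_η ≤ sup_{x > 0} | P(|ξ| ≤ x) − P(|η| ≤ x) | ≤ C · (λ_η − λ_ξ)/λ_ξ. -/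
open MeasureTheory ProbabilityTheory Real NNReal

lemma gaussianReal_abs_le_eq_standard {l : ℝ≥0} (hl : 0 < l) (x : ℝ) :
    gaussianReal 0 l {y : ℝ | |y| ≤ x} = gaussianReal 0 1 {y : ℝ | |y| ≤ x / √(l : ℝ)} := by
  have hs : 0 < √(l : ℝ) := Real.sqrt_pos.2 (by exact_mod_cast hl)
  have hmap : (gaussianReal 0 1).map (√(l : ℝ) * ·) = gaussianReal 0 l := by
    rw [gaussianReal_map_const_mul]
    congr 1
    · simp
    · ext
      simp
  rw [← hmap, Measure.map_apply (by fun_prop)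
    (measurableSet_le (by fun_prop) measurable_const)]
  congr 1
  ext y
  simp only [Set.mem_preimage, Set.mem_ofPred_eq, abs_mul, abs_of_pos hs]
  rw [le_div_iff₀ hs, mul_comm]

lemma gaussianReal_abs_le_eq_intervalIntegral {t : ℝ} (ht : 0 ≤ t) :
    (gaussianReal 0 1 {y : ℝ | |y| ≤ t}).toReal = ∫ y in -t..t, gaussianPDFReal 0 1 y := by
  have hset : {y : ℝ | |y| ≤ t} = Set.Icc (-t) t := by
    ext y
    simp [abs_le]
  rw [hset, gaussianReal_apply_eq_integral 0 one_ne_zero, ENNReal.toReal_ofReal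
    (integral_nonneg fun y => gaussianPDFReal_nonneg _ _ _), integral_Icc_eq_integral_Ioc,
    intervalIntegral.integral_of_le (by linarith)]

lemma intervalIntegrable_gaussianPDFReal (μ : ℝ) (v : ℝ≥0) (a b : ℝ) :
    IntervalIntegrable (gaussianPDFReal μ v) volume a b :=
  (integrable_gaussianPDFReal μ v).intervalIntegrable

lemma gaussianReal_abs_le_sub {a b : ℝ} (hb : 0 ≤ b) (hba : b ≤ a) :
    (gaussianReal 0 1 {y : ℝ | |y| ≤ a}).toReal - (gaussianReal 0 1 {y : ℝ | |y| ≤ b}).toReal =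
      2 * ∫ y in b..a, gaussianPDFReal 0 1 y := by
  rw [gaussianReal_abs_le_eq_intervalIntegral (hb.trans hba),
    gaussianReal_abs_le_eq_intervalIntegral hb]
  have hint := intervalIntegrable_gaussianPDFReal 0 1
  have h₁ := intervalIntegral.integral_add_adjacent_intervals (hint (-a) (-b)) (hint (-b) b)
  have h₂ := intervalIntegral.integral_add_adjacent_intervals (hint (-a) b) (hint b a)
  have hneg : ∫ y in -a..-b, gaussianPDFReal 0 1 y = ∫ y in b..a, gaussianPDFReal 0 1 y := by
    rw [← intervalIntegral.integral_comp_neg]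
    simp [gaussianPDFReal]
  linarith

lemma gaussianPDFReal_zero_one_anti {x y : ℝ} (hx : 0 ≤ x) (hxy : x ≤ y) :
    gaussianPDFReal 0 1 y ≤ gaussianPDFReal 0 1 x := by
  simp only [gaussianPDFReal, sub_zero]
  gcongr

lemma gaussianPDFReal_zero_one_le_exp (x : ℝ) : gaussianPDFReal 0 1 x ≤ rexp (-(x ^ 2 / 2)) := by
  simp only [gaussianPDFReal, sub_zero, NNReal.coe_one, mul_one, neg_div]
  refine mul_le_of_le_one_left (exp_pos _).le (inv_le_one_of_one_le₀ ?_)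
  rw [Real.one_le_sqrt]
  linarith [Real.pi_gt_three]

lemma mul_gaussianPDFReal_zero_one_le_one {x : ℝ} (hx : 0 ≤ x) :
    x * gaussianPDFReal 0 1 x ≤ 1 := by
  have h := mul_le_mul_of_nonneg_left (gaussianPDFReal_zero_one_le_exp x) hx
  refine h.trans ?_
  rw [exp_neg, ← div_eq_mul_inv, div_le_one (exp_pos _)]
  nlinarith [Real.add_one_le_exp (x ^ 2 / 2), sq_nonneg (x - 1)]

lemma gaussianReal_abs_le_sub_le {a b : ℝ} (hb : 0 ≤ b) (hba : b ≤ a) :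
    (gaussianReal 0 1 {y : ℝ | |y| ≤ a}).toReal - (gaussianReal 0 1 {y : ℝ | |y| ≤ b}).toReal ≤
      2 * ((a - b) * gaussianPDFReal 0 1 b) := by
  rw [gaussianReal_abs_le_sub hb hba]
  have h := intervalIntegral.integral_mono_on hba
    (intervalIntegrable_gaussianPDFReal 0 1 b a) intervalIntegrable_const
    fun y hy => gaussianPDFReal_zero_one_anti hb hy.1
  rw [intervalIntegral.integral_const, smul_eq_mul] at h
  linarith

lemma le_gaussianReal_abs_le_sub {a b : ℝ} (hb : 0 ≤ b) (hba : b ≤ a) :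
    2 * ((a - b) * gaussianPDFReal 0 1 a) ≤
      (gaussianReal 0 1 {y : ℝ | |y| ≤ a}).toReal -
        (gaussianReal 0 1 {y : ℝ | |y| ≤ b}).toReal := by
  rw [gaussianReal_abs_le_sub hb hba]
  have h := intervalIntegral.integral_mono_on hba
    intervalIntegrable_const (intervalIntegrable_gaussianPDFReal 0 1 b a)
    fun y hy => gaussianPDFReal_zero_one_anti (hb.trans hy.1) hy.2
  rw [intervalIntegral.integral_const, smul_eq_mul] at h
  linarith

lemma abs_gaussianReal_abs_le_sub_le {l m : ℝ≥0} (hl : 0 < l) (hlm : l < m) {x : ℝ} (hx : 0 < x) :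
    |(gaussianReal 0 l {y : ℝ | |y| ≤ x}).toReal - (gaussianReal 0 m {y : ℝ | |y| ≤ x}).toReal| ≤
      2 * (((m : ℝ) - l) / l) := by
  have hl' : (0 : ℝ) < l := by exact_mod_cast hl
  have hlm' : (l : ℝ) < m := by exact_mod_cast hlm
  have hs : 0 < √(l : ℝ) := Real.sqrt_pos.2 hl'
  have ht : 0 < √(m : ℝ) := Real.sqrt_pos.2 (hl'.trans hlm')
  have hst : √(l : ℝ) ≤ √(m : ℝ) := Real.sqrt_le_sqrt hlm'.le
  have hb : 0 ≤ x / √(m : ℝ) := by positivity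
  have hba : x / √(m : ℝ) ≤ x / √(l : ℝ) := by gcongr
  rw [gaussianReal_abs_le_eq_standard hl, gaussianReal_abs_le_eq_standard (hl.trans hlm),
    abs_of_nonneg]
  · refine (gaussianReal_abs_le_sub_le hb hba).trans ?_
    have hsub : x / √(l : ℝ) - x / √(m : ℝ) = (√(m : ℝ) / √(l : ℝ) - 1) * (x / √(m : ℝ)) := by
      field_simp
    have hr : 1 ≤ √(m : ℝ) / √(l : ℝ) := (one_le_div hs).2 hst
    have hratio : ((m : ℝ) - l) / l = (√(m : ℝ) / √(l : ℝ)) ^ 2 - 1 := by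
      rw [div_pow, Real.sq_sqrt hl'.le, Real.sq_sqrt (hl'.trans hlm').le]
      field_simp
    rw [hsub, hratio, mul_assoc]
    have h := mul_le_of_le_one_right (sub_nonneg.2 hr) (mul_gaussianPDFReal_zero_one_le_one hb)
    nlinarith
  · refine le_trans ?_ (le_gaussianReal_abs_le_sub hb hba)
    have := gaussianPDFReal_nonneg 0 1 (x / √(l : ℝ))
    have := sub_nonneg.2 hba
    positivity

lemma le_abs_gaussianReal_abs_le_sqrt_sub {l m : ℝ≥0} (hl : 0 < l) (hlm : l < m) :
    gaussianPDFReal 0 1 1 * (((m : ℝ) - l) / m) ≤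
      |(gaussianReal 0 l {y : ℝ | |y| ≤ √(l : ℝ)}).toReal -
        (gaussianReal 0 m {y : ℝ | |y| ≤ √(l : ℝ)}).toReal| := by
  have hl' : (0 : ℝ) < l := by exact_mod_cast hl
  have hlm' : (l : ℝ) < m := by exact_mod_cast hlm
  have hs : 0 < √(l : ℝ) := Real.sqrt_pos.2 hl'
  have ht : 0 < √(m : ℝ) := Real.sqrt_pos.2 (hl'.trans hlm')
  have hst : √(l : ℝ) ≤ √(m : ℝ) := Real.sqrt_le_sqrt hlm'.le
  rw [gaussianReal_abs_le_eq_standard hl, gaussianReal_abs_le_eq_standard (hl.trans hlm),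
    div_self hs.ne']
  have hb : 0 ≤ √(l : ℝ) / √(m : ℝ) := by positivity
  have hb1 : √(l : ℝ) / √(m : ℝ) ≤ 1 := (div_le_one ht).2 hst
  refine le_trans ?_ ((le_gaussianReal_abs_le_sub hb hb1).trans (le_abs_self _))
  have hratio : ((m : ℝ) - l) / m = 1 - (√(l : ℝ) / √(m : ℝ)) ^ 2 := by
    rw [div_pow, Real.sq_sqrt hl'.le, Real.sq_sqrt (hl'.trans hlm').le, _root_.sub_div,
      div_self (hl'.trans hlm').ne']
  have h : ((m : ℝ) - l) / m ≤ 2 * (1 - √(l : ℝ) / √(m : ℝ)) := by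
    rw [hratio]
    nlinarith [sq_nonneg (1 - √(l : ℝ) / √(m : ℝ))]
  nlinarith [mul_le_mul_of_nonneg_left h (gaussianPDFReal_nonneg 0 1 1)]

/-- **One-dimensional two-sided Gaussian comparison.** For centered real Gaussians
`ξ ~ N(0, lξ)` and `η ~ N(0, lη)` with `0 < lξ < lη`, there are absolute constants
`0 < c ≤ C` with
`c (lη - lξ)/lη ≤ sup_{x>0} |P(|ξ| ≤ x) - P(|η| ≤ x)| ≤ C (lη - lξ)/lξ`. -/
theorem one_dimensional_two_sided_comparison :
    ∃ c C : ℝ, 0 < c ∧ c ≤ C ∧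
      ∀ lξ lη : ℝ≥0, 0 < lξ → lξ < lη →
        c * (((lη : ℝ) - lξ) / lη) ≤
          (⨆ x : {x : ℝ // 0 < x},
            |((gaussianReal 0 lξ) {y : ℝ | |y| ≤ (x : ℝ)}).toReal -
              ((gaussianReal 0 lη) {y : ℝ | |y| ≤ (x : ℝ)}).toReal|) ∧
        (⨆ x : {x : ℝ // 0 < x},
            |((gaussianReal 0 lξ) {y : ℝ | |y| ≤ (x : ℝ)}).toReal -
              ((gaussianReal 0 lη) {y : ℝ | |y| ≤ (x : ℝ)}).toReal|) ≤
          C * (((lη : ℝ) - lξ) / lξ) := by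
  refine ⟨gaussianPDFReal 0 1 1, 2, gaussianPDFReal_pos 0 1 1 one_ne_zero, ?_,
    fun lξ lη hξ hξη => ⟨?_, ?_⟩⟩
  · linarith [mul_gaussianPDFReal_zero_one_le_one zero_le_one]
  · refine le_ciSup_of_le ⟨2 * (((lη : ℝ) - lξ) / lξ), ?_⟩
      ⟨√(lξ : ℝ), Real.sqrt_pos.2 (by exact_mod_cast hξ)⟩
      (le_abs_gaussianReal_abs_le_sqrt_sub hξ hξη)
    rintro _ ⟨x, rfl⟩
    exact abs_gaussianReal_abs_le_sub_le hξ hξη x.2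
  · have : Nonempty {x : ℝ // 0 < x} := ⟨⟨1, one_pos⟩⟩
    exact ciSup_le fun x => abs_gaussianReal_abs_le_sub_le hξ hξη x.2
end

section
/- (Failure of anti-concentration with only one nonzero eigenvalue) Let ξ be a Gaussian vector in ℝ² with mean zero and covariance matrix diag(1, 0), i.e., λ_{1ξ} = 1 and λ_{2ξ} = 0. Then for every ε with 0 < ε ≤ log 2, sup_{x > 0} P( x < ‖ξ‖² < x + ε ) ≥ √ε / (2√π). -/
open MeasureTheory ProbabilityTheory Real

/-- Where `z² ≤ log 2`, the standard Gaussian density is at least `1 / (2√π)`. -/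
lemma inv_two_mul_sqrt_pi_le_gaussianPDFReal {z : ℝ} (hz : z ^ 2 ≤ Real.log 2) :
    (2 * Real.sqrt π)⁻¹ ≤ gaussianPDFReal 0 1 z := by
  have hexp : (Real.sqrt 2)⁻¹ ≤ Real.exp (-z ^ 2 / 2) := by
    have h : (Real.sqrt 2)⁻¹ = Real.exp (-Real.log 2 / 2) := by
      rw [← Real.exp_log (show 0 < (Real.sqrt 2)⁻¹ by positivity), Real.log_inv,
        Real.log_sqrt (by norm_num), neg_div]
    rw [h]
    gcongr
  have hsplit : (2 * Real.sqrt π)⁻¹ = (Real.sqrt (2 * π))⁻¹ * (Real.sqrt 2)⁻¹ := by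
    rw [← mul_inv, Real.sqrt_mul (by norm_num), mul_right_comm, Real.mul_self_sqrt (by norm_num)]
  rw [hsplit, gaussianPDFReal]
  simp only [NNReal.coe_one, mul_one, sub_zero]
  gcongr

/-- A standard Gaussian `Z` satisfies `ε/4 < Z² < ε/4 + ε` with probability at least
`√ε / (2√π)`. -/
lemma le_gaussianReal_sq_mem_Ioo {ε : ℝ} (hε : 0 < ε) (hε' : ε ≤ Real.log 2) :
    ENNReal.ofReal (Real.sqrt ε / (2 * Real.sqrt π)) ≤
      gaussianReal 0 1 {z | ε / 4 < z ^ 2 ∧ z ^ 2 < ε / 4 + ε} := by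
  obtain ⟨a, ha, rfl⟩ : ∃ a, 0 < a ∧ (2 * a) ^ 2 = ε :=
    ⟨Real.sqrt ε / 2, by positivity, by rw [mul_div_cancel₀ _ two_ne_zero, Real.sq_sqrt hε.le]⟩
  rw [Real.sqrt_sq (by positivity)]
  set S : Set ℝ := Set.Ioo a (2 * a) ∪ Set.Ioo (-(2 * a)) (-a) with hS
  have hSmeas : MeasurableSet S := measurableSet_Ioo.union measurableSet_Ioo
  have hSsq : ∀ z ∈ S, a ^ 2 < z ^ 2 ∧ z ^ 2 < (2 * a) ^ 2 := by
    rintro z (⟨h₁, h₂⟩ | ⟨h₁, h₂⟩) <;> constructor <;> nlinarith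
  have hvol : volume S = ENNReal.ofReal (2 * a) := by
    rw [hS, measure_union _ measurableSet_Ioo, Real.volume_Ioo, Real.volume_Ioo,
      ← ENNReal.ofReal_add (by linarith) (by linarith)]
    · congr 1
      ring
    · refine Set.disjoint_left.2 fun z h₁ h₂ => ?_
      linarith [h₁.1, h₂.2]
  calc ENNReal.ofReal (2 * a / (2 * Real.sqrt π))
      = ENNReal.ofReal (2 * Real.sqrt π)⁻¹ * volume S := by
        rw [hvol, ← ENNReal.ofReal_mul (by positivity), div_eq_inv_mul]
    _ = ∫⁻ _ in S, ENNReal.ofReal (2 * Real.sqrt π)⁻¹ := (setLIntegral_const _ _).symm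
    _ ≤ ∫⁻ z in S, gaussianPDF 0 1 z :=
        setLIntegral_mono' hSmeas fun z hz => ENNReal.ofReal_le_ofReal <|
          inv_two_mul_sqrt_pi_le_gaussianPDFReal ((hSsq z hz).2.le.trans hε')
    _ = gaussianReal 0 1 S := (gaussianReal_apply 0 one_ne_zero S).symm
    _ ≤ _ := measure_mono fun z hz => by
        obtain ⟨h₁, h₂⟩ := hSsq z hz
        constructor <;> nlinarith

/-- **Failure of anti-concentration with only one nonzero eigenvalue.** Let `ξ` be a
mean-zero Gaussian vector in `ℝ²` with covariance `diag(1, 0)`, i.e. `ξ = (Z, 0)` with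
`Z ~ N(0,1)`. Then for every `0 < ε ≤ log 2`,
`sup_{x>0} P(x < ‖ξ‖² < x + ε) ≥ √ε / (2√π)`. -/
theorem anticoncentration_failure_degenerate
    (Ω : Type) [MeasurableSpace Ω] (P : Measure Ω) [IsProbabilityMeasure P]
    (Z : Ω → ℝ) (hZ : Measure.map Z P = gaussianReal 0 1)
    (ξ : Ω → EuclideanSpace ℝ (Fin 2))
    (hξ : ∀ ω, ξ ω = fun i : Fin 2 => if i = 0 then Z ω else 0)
    (ε : ℝ) (hε : 0 < ε) (hε' : ε ≤ Real.log 2) :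
    Real.sqrt ε / (2 * Real.sqrt π) ≤
      ⨆ x : {x : ℝ // 0 < x},
        (P {ω | (x : ℝ) < ‖ξ ω‖ ^ 2 ∧ ‖ξ ω‖ ^ 2 < (x : ℝ) + ε}).toReal := by
  have hZm : AEMeasurable Z P := by
    refine AEMeasurable.of_map_ne_zero ?_
    rw [hZ]
    exact IsProbabilityMeasure.ne_zero _
  have hnorm : ∀ ω, ‖ξ ω‖ ^ 2 = Z ω ^ 2 := fun ω => by
    simp [EuclideanSpace.norm_sq_eq, hξ ω]
  have hbdd : BddAbove (Set.range fun x : {x : ℝ // 0 < x} =>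
      (P {ω | (x : ℝ) < ‖ξ ω‖ ^ 2 ∧ ‖ξ ω‖ ^ 2 < (x : ℝ) + ε}).toReal) :=
    ⟨1, by rintro _ ⟨x, rfl⟩; exact measureReal_le_one⟩
  refine le_trans ?_ (le_ciSup hbdd ⟨ε / 4, by positivity⟩)
  have hmeas : MeasurableSet {z : ℝ | ε / 4 < z ^ 2 ∧ z ^ 2 < ε / 4 + ε} :=
    measurableSet_Ioo.preimage (f := fun z : ℝ => z ^ 2) (by fun_prop)
  have key := le_gaussianReal_sq_mem_Ioo hε hε'
  rw [← hZ, Measure.map_apply_of_aemeasurable hZm hmeas] at key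
  simp only [hnorm]
  exact (ENNReal.ofReal_le_iff_le_toReal (measure_ne_top _ _)).1 key
end
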